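/- arXiv:2207.13209 — 2 statements merged into one kernel-verified Lean document; each statement's English description precedes it below -/
import Mathlib

section
/- Suppose χ_i, χ_j, χ_k are weights of V (as characters of T) satisfying χ_i·χ_k = χ_j². Then χ_i(g) = χ_j(g) = χ_k(g). -/
/-!
Setting: `G` is a connected simple complex Lie group, `ρ : G → GL(V)` a faithful
irreducible representation, `g ∈ G` semisimple, `T` a maximal torus containing `g` with
Lie algebra `𝔱`, and `x ∈ 𝔱` with `ρ(g) = ρ_*(x)`.  The characters `χ_1, …, χ_n` of `T`
on a basis of weight vectors of `V` correspond to linear functionals `t*_1, …, t*_n ∈ 𝔱*`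
via `χ_j (exp y) = exp (t*_j y)`; then `χ_j(g) = t*_j(x)` for all `j`, and any
multiplicative relation `χ_1^{a_1} ⋯ χ_n^{a_n} = 1` (`a_j ∈ ℤ`) implies
`a_1 t*_1 + ⋯ + a_n t*_n = 0`.  These facts are recorded as hypotheses below.
-/

/-- A relation `f i * f k = f j * f j` in a commutative group, written as a product of integer
powers over the whole family `f`. -/
theorem prod_zpow_single_add_single_sub_single {ι M : Type*} [Fintype ι] [DecidableEq ι]
    [CommGroup M] (f : ι → M) {i j k : ι} (h : f i * f k = f j * f j) :
    ∏ l, f l ^ ((Pi.single i 1 + Pi.single k 1 - Pi.single j 2 : ι → ℤ) l) = 1 := by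
  have hsingle : ∀ (m : ι) (c : ℤ), ∏ l, f l ^ ((Pi.single m c : ι → ℤ) l) = f m ^ c :=
    fun m c => by
      rw [Finset.prod_eq_single m (fun l _ hl => by simp [hl]) (by simp), Pi.single_eq_same]
  simp only [Pi.add_apply, Pi.sub_apply, zpow_sub, zpow_add, Finset.prod_mul_distrib,
    Finset.prod_inv_distrib, hsingle]
  rw [zpow_one, zpow_one, zpow_two, h, mul_inv_cancel]

/-- If `χ_i`, `χ_j`, `χ_k` are three weights of `V` with `χ_i · χ_k = χ_j ^ 2`, then
`χ_i(g) = χ_j(g) = χ_k(g)`. -/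
theorem weights_in_geometric_progression_take_equal_values
    {n : ℕ} (T : Type*) [CommGroup T]                      -- the maximal torus
    (𝔱 : Type*) [AddCommGroup 𝔱] [Module ℂ 𝔱]               -- its Lie algebra
    (expT : 𝔱 → T)                                           -- the exponential map
    (ρ : Representation ℂ T (Fin n → ℂ))                     -- the action of T on V = ℂⁿ
    (χ : Fin n → (T →* ℂˣ))                                  -- the weights of V
    (hweight : ∀ (l : Fin n) (t : T),                         -- e_l is a weight vector of weight χ_l
      ρ t (Pi.single l 1 : Fin n → ℂ) = (χ l t : ℂ) • (Pi.single l 1 : Fin n → ℂ))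
    (tstar : Fin n → (𝔱 →ₗ[ℂ] ℂ))                           -- the weight functionals
    (hcompat : ∀ (l : Fin n) (y : 𝔱),                        -- χ_l (exp y) = exp (t*_l y)
      (χ l (expT y) : ℂ) = Complex.exp (tstar l y))
    (hrel : ∀ a : Fin n → ℤ,                                  -- multiplicative relations give linear relations
      (∏ l, (χ l) ^ (a l)) = 1 → (∑ l, (a l : ℂ) • tstar l) = 0)
    (g : T) (x : 𝔱)
    (hgx : ∀ l : Fin n, (χ l g : ℂ) = tstar l x)              -- ρ(g) = ρ_*(x) on weight vectors
    (i j k : Fin n) (h : χ i * χ k = χ j * χ j) :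
    (χ i g : ℂ) = (χ j g : ℂ) ∧ (χ j g : ℂ) = (χ k g : ℂ) := by
  have hprod := prod_zpow_single_add_single_sub_single χ h
  have hsum : tstar i x + tstar k x - 2 * tstar j x = 0 := by
    have hsingle : ∀ (m : Fin n) (c : ℤ),
        ∑ l, (((Pi.single m c : Fin n → ℤ) l : ℤ) : ℂ) * tstar l x = c * tstar m x := fun m c => by
      rw [Finset.sum_eq_single m (fun l _ hl => by simp [hl]) (by simp), Pi.single_eq_same]
    have hx := LinearMap.congr_fun (hrel _ hprod) x
    simpa only [LinearMap.sum_apply, LinearMap.smul_apply, smul_eq_mul, Pi.add_apply,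
      Pi.sub_apply, Int.cast_add, Int.cast_sub, add_mul, sub_mul, Finset.sum_add_distrib,
      Finset.sum_sub_distrib, hsingle, Int.cast_one, Int.cast_ofNat, one_mul,
      LinearMap.zero_apply] using hx
  have hmul : (χ i g : ℂ) * χ k g = χ j g * χ j g := by
    exact_mod_cast congrArg Units.val (DFunLike.congr_fun h g)
  rw [← hgx, ← hgx, ← hgx] at hsum
  have hij : (χ i g : ℂ) - χ j g = 0 := by
    refine pow_eq_zero_iff two_ne_zero |>.mp ?_
    linear_combination (χ i g : ℂ) * hsum - hmul
  exact ⟨by linear_combination hij, by linear_combination hij - hsum⟩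
end

section
/- Let m ≥ 2 and 1 ≤ j ≤ m−1 be integers, V = ⋀^j ℂ^m, and let G be the image of SL_m(ℂ) in GL(V) under the j-th exterior power representation, with Lie algebra 𝔤 ⊆ End(V) the image of 𝔰𝔩_m(ℂ) under the induced Lie algebra representation. Then G ∩ 𝔤 ≠ ∅ as subsets of End(V). -/
open ExteriorAlgebra

/-- The wedge `v 0 ∧ ⋯ ∧ v (j-1)`, as an element of the `j`-th exterior power
`⋀[ℂ]^j (ℂ^m)`. -/
noncomputable def wedge (m j : ℕ) (v : Fin j → (Fin m → ℂ)) : ⋀[ℂ]^j (Fin m → ℂ) :=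
  ⟨ExteriorAlgebra.ιMulti ℂ j v,
    ExteriorAlgebra.ιMulti_range ℂ j (Set.mem_range_self v)⟩

theorem wedge_eq_ιMulti (m j : ℕ) (v : Fin j → (Fin m → ℂ)) :
    wedge m j v = exteriorPower.ιMulti ℂ j v :=
  rfl

/-- Endomorphisms of the exterior power that scale the wedges of distinct standard basis vectors
by the same factors are equal. -/
theorem exteriorPower_end_ext_single {m j : ℕ} {f g : Module.End ℂ (⋀[ℂ]^j (Fin m → ℂ))}
    (h : ∀ v : Fin j → Fin m, Function.Injective v →
      f (wedge m j fun k => Pi.single (v k) 1) = g (wedge m j fun k => Pi.single (v k) 1)) :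
    f = g := by
  refine exteriorPower.linearMap_ext (Module.Basis.ext_alternating (Pi.basisFun ℂ (Fin m)) ?_)
  intro v hv
  simpa [wedge_eq_ιMulti] using h v hv

theorem diagonal_mulVec_single_one {m : ℕ} (a : Fin m → ℂ) (i : Fin m) :
    (Matrix.diagonal a).mulVec (Pi.single i 1) = a i • (Pi.single i 1 : Fin m → ℂ) := by
  ext l
  by_cases h : l = i <;> simp [Matrix.mulVec_diagonal, h]

theorem wedge_smul (m j : ℕ) (c : Fin j → ℂ) (v : Fin j → (Fin m → ℂ)) :
    wedge m j (fun k => c k • v k) = (∏ k, c k) • wedge m j v := by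
  simp only [wedge_eq_ιMulti]
  exact (exteriorPower.ιMulti ℂ j).toMultilinearMap.map_smul_univ c v

theorem wedge_update_smul_self (m j : ℕ) (c : ℂ) (v : Fin j → (Fin m → ℂ)) (k : Fin j) :
    wedge m j (Function.update v k (c • v k)) = c • wedge m j v := by
  simp only [wedge_eq_ιMulti]
  rw [AlternatingMap.map_update_smul, Function.update_eq_self]

/-- Weights `a`, `x` whose products, respectively sums, over any `j` distinct indices agree. -/
theorem exists_weights_prod_eq_sum {m j : ℕ} (hj : 0 < j) (hjm : j < m) :
    ∃ a x : Fin m → ℂ, ∏ i, a i = 1 ∧ ∑ i, x i = 0 ∧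
      ∀ v : Fin j → Fin m, Function.Injective v → ∏ k, a (v k) = ∑ k, x (v k) := by
  have hj0 : (j : ℂ) ≠ 0 := by exact_mod_cast hj.ne'
  have hjm0 : (j : ℂ) - m ≠ 0 := sub_ne_zero.2 (by exact_mod_cast hjm.ne)
  obtain ⟨b, hb⟩ := IsAlgClosed.exists_pow_nat_eq ((j : ℂ) / (j - m)) (hj.trans hjm)
  let i₀ : Fin m := ⟨0, hj.trans hjm⟩
  refine ⟨fun i => b * if i = i₀ then ((j : ℂ) - m) / j else 1,
    fun i => b ^ j / j * (1 + if i = i₀ then -(m : ℂ) else 0), ?_, ?_, fun v hv => ?_⟩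
  · rw [Finset.prod_mul_distrib]
    simp only [Finset.prod_const, Finset.card_univ, Fintype.card_fin, Finset.prod_ite_eq',
      Finset.mem_univ, if_true, hb]
    field_simp
  · rw [← Finset.mul_sum, Finset.sum_add_distrib]
    simp
  · rw [Finset.prod_mul_distrib, ← Finset.mul_sum, Finset.sum_add_distrib]
    by_cases h : ∃ k₀, v k₀ = i₀
    · obtain ⟨k₀, hk₀⟩ := h
      have hk (k : Fin j) : v k = i₀ ↔ k = k₀ := by rw [← hk₀, hv.eq_iff]
      simp [hk]
      field_simp
      ring
    · push Not at h
      simp [h]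
      field_simp

/-- Let `2 ≤ m`, `1 ≤ j ≤ m − 1` and `V = ⋀^j ℂ^m`.  Let `P` be the `j`-th exterior power
representation of matrices (`P A (v₁ ∧ ⋯ ∧ v_j) = A v₁ ∧ ⋯ ∧ A v_j`) and `δ` its
derivative (`δ X (v₁ ∧ ⋯ ∧ v_j) = Σ_k v₁ ∧ ⋯ ∧ X v_k ∧ ⋯ ∧ v_j`).  Then the image `G` of
`SL_m(ℂ)` under `P` meets the image `𝔤` of `𝔰𝔩_m(ℂ)` under `δ`, as subsets of
`End (⋀^j ℂ^m)`. -/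
theorem exterior_power_group_meets_lie_algebra (m j : ℕ)
    (hm : 2 ≤ m) (hj : 1 ≤ j) (hjm : j ≤ m - 1)
    (P : Matrix (Fin m) (Fin m) ℂ → Module.End ℂ (⋀[ℂ]^j (Fin m → ℂ)))
    (hP : ∀ (A : Matrix (Fin m) (Fin m) ℂ) (v : Fin j → (Fin m → ℂ)),
      P A (wedge m j v) = wedge m j (fun k => A.mulVec (v k)))
    (δ : Matrix (Fin m) (Fin m) ℂ → Module.End ℂ (⋀[ℂ]^j (Fin m → ℂ)))
    (hδ : ∀ (X : Matrix (Fin m) (Fin m) ℂ) (v : Fin j → (Fin m → ℂ)),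
      δ X (wedge m j v) = ∑ k : Fin j, wedge m j (Function.update v k (X.mulVec (v k)))) :
    ((P '' {A : Matrix (Fin m) (Fin m) ℂ | A.det = 1}) ∩
      (δ '' {X : Matrix (Fin m) (Fin m) ℂ | X.trace = 0})).Nonempty := by
  obtain ⟨a, x, ha, hx, h⟩ := exists_weights_prod_eq_sum (m := m) (j := j) hj (by omega)
  refine ⟨P (Matrix.diagonal a), ⟨_, by simpa using ha, rfl⟩,
    ⟨Matrix.diagonal x, by simpa using hx, exteriorPower_end_ext_single fun v hv => ?_⟩⟩
  rw [hP, hδ]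
  simp only [diagonal_mulVec_single_one]
  rw [wedge_smul, h v hv, Finset.sum_smul]
  exact Finset.sum_congr rfl fun k _ =>
    wedge_update_smul_self m j (x (v k)) (fun k => Pi.single (v k) 1) k
end
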